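/- arXiv:1301.3335 — 2 statements merged into one kernel-verified Lean document; each statement's English description precedes it below -/
import Mathlib

section
/- (Compactness for the time-discretized scheme, Theorem 5.2.) Suppose that V is bounded or that b − a ≤ √(m/(32c₂)). Let h_N > 0 with h_N → 0 as N → ∞, and for each N fix a partition of [a,b] with mesh at most h_N and associated discrete action 𝒜^{[h_N]}. If (π^{(N)})_{N∈ℕ} is a sequence in 𝒫(C([a,b];ℝⁿ)) such that there is one compact set K ⊆ ℝⁿ with (pr_a#π^{(N)})(K) = 1 for all N, and sup_N ∫ 𝒜^{[h_N]}(γ) dπ^{(N)}(γ) < ∞, then (π^{(N)}) is relatively compact with respect to weak convergence: every subsequence admits a further subsequence converging weakly to some element of 𝒫(C([a,b];ℝⁿ)). -/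
open MeasureTheory Filter Topology
open scoped ENNReal NNReal

noncomputable section

/-- Euclidean space `ℝⁿ`. -/
abbrev Eu (n : ℕ) := EuclideanSpace ℝ (Fin n)

/-- The space `C([a,b];ℝⁿ)` of continuous curves with the supremum metric. -/
abbrev CPath (a b : ℝ) (n : ℕ) := C(Set.Icc a b, Eu n)

/-- We endow the path space with its Borel σ-algebra. -/
noncomputable instance pathMeasurableSpace (a b : ℝ) (n : ℕ) :
    MeasurableSpace (CPath a b n) := borel _

instance pathBorelSpace (a b : ℝ) (n : ℕ) : BorelSpace (CPath a b n) :=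
  ⟨rfl⟩

/-- Evaluation of a curve at time `t ∈ [a,b]` (junk value `0` outside `[a,b]`). -/
def pev {a b : ℝ} {n : ℕ} (γ : CPath a b n) (t : ℝ) : Eu n :=
  if ht : t ∈ Set.Icc a b then γ ⟨t, ht⟩ else 0

/-- A curve is absolutely continuous if it has a Bochner-integrable derivative `g` with
`γ t = γ s + ∫_s^t g`. -/
def IsACC {a b : ℝ} {n : ℕ} (γ : CPath a b n) : Prop :=
  ∃ g : ℝ → Eu n, IntegrableOn g (Set.Icc a b) ∧
    ∀ s t : Set.Icc a b, γ t = γ s + ∫ u in (s : ℝ)..(t : ℝ), g u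

open Classical in
/-- The action `𝒜(γ) = ∫_a^b L(γ(t), γ̇(t)) dt ∈ (−∞,+∞]`, equal to `+∞` on curves that are
not absolutely continuous (and, by the convention that the integral is `+∞` when the
integrand fails to be integrable -- its negative part being automatically integrable --
also on absolutely continuous curves with non-integrable Lagrangian). -/
def action {n : ℕ} (L : Eu n → Eu n → ℝ) (a b : ℝ) (γ : CPath a b n) : EReal :=
  if h : IsACC γ then
    (if IntegrableOn (fun t => L (pev γ t) (h.choose t)) (Set.Icc a b) then
      (((∫ t in Set.Icc a b, L (pev γ t) (h.choose t)) : ℝ) : EReal)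
    else ⊤)
  else ⊤

/-- Positive part of an extended real, as `ℝ≥0∞`. -/
def epos (x : EReal) : ℝ≥0∞ := if x = ⊤ then ⊤ else ENNReal.ofReal x.toReal

/-- The integral `∫ F dπ ∈ [−∞,+∞]` of an extended-real-valued function, defined as the
difference of the lower integrals of the positive and negative parts. -/
def mint {X : Type*} [MeasurableSpace X] (F : X → EReal) (π : Measure X) : EReal :=
  ((∫⁻ γ, epos (F γ) ∂π : ℝ≥0∞) : EReal) - ((∫⁻ γ, epos (-(F γ)) ∂π : ℝ≥0∞) : EReal)

open Classical in
/-- The constrained functional `𝔸_{μa,μb}(π) = ∫ 𝒜 dπ` if `pr_a#π = μa` and `pr_b#π = μb`,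
and `+∞` otherwise, for a given (extended-real-valued) action functional `F`. -/
def aFun {a b : ℝ} {n : ℕ} (F : CPath a b n → EReal) (μa μb : Measure (Eu n))
    (π : Measure (CPath a b n)) : EReal :=
  if Measure.map (fun γ => pev γ a) π = μa ∧ Measure.map (fun γ => pev γ b) π = μb then
    mint F π
  else ⊤

/-- Weak convergence of a sequence of measures: convergence of the integrals of all bounded
continuous functions. -/
def WeakLim {X : Type*} [TopologicalSpace X] [MeasurableSpace X]
    (πs : ℕ → Measure X) (π : Measure X) : Prop :=
  ∀ φ : BoundedContinuousFunction X ℝ,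
    Tendsto (fun N => ∫ x, φ x ∂(πs N)) atTop (𝓝 (∫ x, φ x ∂π))

/-- The empirical measure `(1/N) ∑_{i=1}^N δ_{x i}`. -/
def emp {X : Type*} [MeasurableSpace X] (N : ℕ) (x : Fin N → X) : Measure X :=
  (N : ℝ≥0∞)⁻¹ • ∑ i : Fin N, Measure.dirac (x i)

/-- The topological support of a measure. -/
def msupp {α : Type*} [TopologicalSpace α] [MeasurableSpace α] (μ : Measure α) : Set α :=
  {x | ∀ U : Set α, IsOpen U → x ∈ U → 0 < μ U}

/-- The set `Γ^min_{K₁,K₂}` of minimizing extremals starting in `K₁` and ending in `K₂`. -/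
def GammaMin {n : ℕ} (L : Eu n → Eu n → ℝ) (a b : ℝ) (K₁ K₂ : Set (Eu n)) :
    Set (CPath a b n) :=
  {γ | IsACC γ ∧ pev γ a ∈ K₁ ∧ pev γ b ∈ K₂ ∧
    ∀ γ' : CPath a b n, IsACC γ' → pev γ' a = pev γ a → pev γ' b = pev γ b →
      action L a b γ ≤ action L a b γ'}

/-- The Lagrangian cost `c(x,y)`: the minimal action among absolutely continuous curves
from `x` to `y`. -/
def cost {n : ℕ} (L : Eu n → Eu n → ℝ) (a b : ℝ) (x y : Eu n) : EReal :=
  ⨅ γ ∈ {γ : CPath a b n | IsACC γ ∧ pev γ a = x ∧ pev γ b = y}, action L a b γ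

/-- The restriction of a continuous curve `ℝ → ℝⁿ` to `[a,b]` as an element of the path
space. -/
def toPath {n : ℕ} (a b : ℝ) (f : ℝ → Eu n) (hf : Continuous f) : CPath a b n :=
  (ContinuousMap.mk f hf).restrict (Set.Icc a b)

/-- `Φ : ℝⁿ × ℝⁿ → C([a,b];ℝⁿ)` is the Euler–Lagrange (Newton) flow map for the Lagrangian
`L(x,v) = (m/2)|v|² − V(x)`: it is continuous and `Φ(x,v)` is a `C²` solution of
`m γ'' = −∇V(γ)` with initial position `x` and initial velocity `v`. -/
def IsNewtonFlow {n : ℕ} (m : ℝ) (V : Eu n → ℝ) (a b : ℝ)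
    (Φ : Eu n × Eu n → CPath a b n) : Prop :=
  Continuous Φ ∧ ∀ x v : Eu n, ∃ f : ℝ → Eu n, ContDiff ℝ 2 f ∧
    (∀ t : Set.Icc a b, Φ (x, v) t = f t) ∧ f a = x ∧ deriv f a = v ∧
    ∀ t ∈ Set.Icc a b, m • deriv (deriv f) t = -gradient V (f t)

/-- The set of `C²` solutions of `m γ'' = −∇V(γ)` starting in `Ka` and ending in `Kb`,
viewed as a subset of the path space. -/
def NewtonSet {n : ℕ} (m : ℝ) (V : Eu n → ℝ) (a b : ℝ) (Ka Kb : Set (Eu n)) :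
    Set (CPath a b n) :=
  {γ | ∃ f : ℝ → Eu n, ContDiff ℝ 2 f ∧ (∀ t : Set.Icc a b, γ t = f t) ∧
    (∀ t ∈ Set.Icc a b, m • deriv (deriv f) t = -gradient V (f t)) ∧
    f a ∈ Ka ∧ f b ∈ Kb}

/-- `γ` is piecewise affine subordinate to the partition `a = τ₀ < … < τ_l = b`. -/
def PiecewiseAffine {n : ℕ} (a b : ℝ) (τ : ℕ → ℝ) (l : ℕ) (γ : CPath a b n) : Prop :=
  ∀ j < l, ∀ t : Set.Icc a b, (t : ℝ) ∈ Set.Icc (τ j) (τ (j + 1)) →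
    γ t = pev γ (τ j) + (((t : ℝ) - τ j) / (τ (j + 1) - τ j)) •
      (pev γ (τ (j + 1)) - pev γ (τ j))

/-- `IsPartition a b τ l h`: `a = τ₀ < τ₁ < … < τ_l = b` is a partition of `[a,b]` of mesh
at most `h`. -/
def IsPartition (a b : ℝ) (τ : ℕ → ℝ) (l : ℕ) (h : ℝ) : Prop :=
  1 ≤ l ∧ τ 0 = a ∧ τ l = b ∧ (∀ j < l, τ j < τ (j + 1)) ∧
    ∀ j < l, τ (j + 1) - τ j ≤ h

/-- The midpoint-rule discrete action, as a (real-valued) sum over the first `l` intervals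
of the partition. -/
def dActionSum {n : ℕ} (m : ℝ) (V : Eu n → ℝ) {a b : ℝ} (τ : ℕ → ℝ) (l : ℕ)
    (γ : CPath a b n) : ℝ :=
  ∑ j ∈ Finset.range l,
    (m / 2 * ‖pev γ (τ (j + 1)) - pev γ (τ j)‖ ^ 2 / (τ (j + 1) - τ j) -
      V ((2 : ℝ)⁻¹ • (pev γ (τ (j + 1)) + pev γ (τ j))) * (τ (j + 1) - τ j))

open Classical in
/-- The discrete action `𝒜^{[h]}`: the midpoint-rule discrete action for piecewise affine
curves subordinate to the partition, `+∞` otherwise. -/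
def dAction {n : ℕ} (m : ℝ) (V : Eu n → ℝ) (a b : ℝ) (τ : ℕ → ℝ) (l : ℕ)
    (γ : CPath a b n) : EReal :=
  if PiecewiseAffine a b τ l γ then ((dActionSum m V τ l γ : ℝ) : EReal) else ⊤

/-- The discrete Euler–Lagrange equations for a piecewise affine curve subordinate to the
partition `a = τ₀ < … < τ_l = b`. -/
def DiscreteEL {n : ℕ} (m : ℝ) (V : Eu n → ℝ) {a b : ℝ} (τ : ℕ → ℝ) (l : ℕ)
    (γ : CPath a b n) : Prop :=
  ∀ j, 1 ≤ j → j < l →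
    m • ((τ j - τ (j - 1))⁻¹ • (pev γ (τ j) - pev γ (τ (j - 1)))) -
      m • ((τ (j + 1) - τ j)⁻¹ • (pev γ (τ (j + 1)) - pev γ (τ j))) =
    ((τ j - τ (j - 1)) / 2) • gradient V ((2 : ℝ)⁻¹ • (pev γ (τ (j - 1)) + pev γ (τ j))) +
      ((τ (j + 1) - τ j) / 2) • gradient V ((2 : ℝ)⁻¹ • (pev γ (τ j) + pev γ (τ (j + 1))))

end

/-- A piecewise affine curve is Hölder-`1/2` with constant governed by its kinetic energy. -/
theorem sq_norm_sub_le_of_piecewise_affine {F : Type*} [NormedAddCommGroup F] [NormedSpace ℝ F]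
    {f : ℝ → F} {τ : ℕ → ℝ} {l : ℕ} (hτ : ∀ j < l, τ j < τ (j + 1))
    (hf : ∀ j < l, ∀ t ∈ Set.Icc (τ j) (τ (j + 1)),
      f t = f (τ j) + ((t - τ j) / (τ (j + 1) - τ j)) • (f (τ (j + 1)) - f (τ j))) :
    ∀ k ≤ l, ∀ s t, τ 0 ≤ s → s ≤ t → t ≤ τ k →
      ‖f t - f s‖ ^ 2 ≤
        (t - s) * ∑ j ∈ Finset.range k, ‖f (τ (j + 1)) - f (τ j)‖ ^ 2 / (τ (j + 1) - τ j) := by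
  intro k
  induction k with
  | zero =>
    intro _ s t h0 hst ht
    obtain rfl : s = t := le_antisymm hst (ht.trans h0)
    simp
  | succ k ih =>
    intro hk s t h0 hst ht
    have hδ : 0 < τ (k + 1) - τ k := sub_pos.2 (hτ k hk)
    have hE : 0 ≤ ∑ j ∈ Finset.range k, ‖f (τ (j + 1)) - f (τ j)‖ ^ 2 / (τ (j + 1) - τ j) :=
      Finset.sum_nonneg fun j hj => div_nonneg (sq_nonneg _)
        (sub_pos.2 (hτ j ((Finset.mem_range.1 hj).trans hk))).le
    have he : 0 ≤ ‖f (τ (k + 1)) - f (τ k)‖ ^ 2 / (τ (k + 1) - τ k) :=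
      div_nonneg (sq_nonneg _) hδ.le
    have hloc : ∀ s t, τ k ≤ s → s ≤ t → t ≤ τ (k + 1) → ‖f t - f s‖ ^ 2 ≤
        (t - s) * (‖f (τ (k + 1)) - f (τ k)‖ ^ 2 / (τ (k + 1) - τ k)) := by
      intro s t hs hst ht
      have hfs : f t - f s =
          ((t - s) / (τ (k + 1) - τ k)) • (f (τ (k + 1)) - f (τ k)) := by
        rw [hf k hk t ⟨hs.trans hst, ht⟩, hf k hk s ⟨hs, hst.trans ht⟩, add_sub_add_left_eq_sub,
          ← sub_smul, ← sub_div, sub_sub_sub_cancel_right]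
      rw [hfs, norm_smul, mul_pow, Real.norm_eq_abs, sq_abs]
      have hle : (t - s) / (τ (k + 1) - τ k) ≤ 1 := (div_le_one hδ).2 (by linarith)
      calc ((t - s) / (τ (k + 1) - τ k)) ^ 2 * ‖f (τ (k + 1)) - f (τ k)‖ ^ 2
          = ((t - s) / (τ (k + 1) - τ k)) *
              ((t - s) * (‖f (τ (k + 1)) - f (τ k)‖ ^ 2 / (τ (k + 1) - τ k))) := by ring
        _ ≤ 1 * ((t - s) * (‖f (τ (k + 1)) - f (τ k)‖ ^ 2 / (τ (k + 1) - τ k))) :=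
          mul_le_mul_of_nonneg_right hle (mul_nonneg (by linarith) he)
        _ = _ := one_mul _
    rw [Finset.sum_range_succ]
    rcases le_total t (τ k) with htk | htk
    · refine (ih (by omega) s t h0 hst htk).trans ?_
      exact mul_le_mul_of_nonneg_left (by linarith) (by linarith)
    rcases le_total (τ k) s with hsk | hsk
    · refine (hloc s t hsk hst ht).trans ?_
      exact mul_le_mul_of_nonneg_left (by linarith) (by linarith)
    have h1 := ih (by omega) s (τ k) h0 hsk le_rfl
    have h2 := hloc (τ k) t le_rfl htk ht
    set E := ∑ j ∈ Finset.range k, ‖f (τ (j + 1)) - f (τ j)‖ ^ 2 / (τ (j + 1) - τ j)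
    set e := ‖f (τ (k + 1)) - f (τ k)‖ ^ 2 / (τ (k + 1) - τ k)
    have htri : ‖f t - f s‖ ≤ ‖f (τ k) - f s‖ + ‖f t - f (τ k)‖ := by
      have := norm_add_le (f (τ k) - f s) (f t - f (τ k))
      rwa [show f (τ k) - f s + (f t - f (τ k)) = f t - f s by abel] at this
    have hx : 0 ≤ τ k - s := by linarith
    have hy : 0 ≤ t - τ k := by linarith
    have hcross : 2 * (‖f (τ k) - f s‖ * ‖f t - f (τ k)‖) ≤ (τ k - s) * e + (t - τ k) * E := by
      refine abs_le_of_sq_le_sq' ?_ (by positivity) |>.2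
      have := mul_le_mul h1 h2 (sq_nonneg _) (mul_nonneg hx hE)
      nlinarith [sq_nonneg ((τ k - s) * e - (t - τ k) * E)]
    have hsq := pow_le_pow_left₀ (norm_nonneg _) htri 2
    nlinarith

/-- Curves starting in `K` whose squared increments are at most `D` times the elapsed time. -/
def holderHalfSet {a b : ℝ} {n : ℕ} (K : Set (Eu n)) (D : ℝ) : Set (CPath a b n) :=
  {γ | pev γ a ∈ K ∧ ∀ s t : Set.Icc a b, ‖γ t - γ s‖ ^ 2 ≤ dist s t * D}

theorem pev_of_mem {a b : ℝ} {n : ℕ} (γ : CPath a b n) {t : ℝ} (ht : t ∈ Set.Icc a b) :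
    pev γ t = γ ⟨t, ht⟩ :=
  dif_pos ht

theorem continuous_pev {a b : ℝ} {n : ℕ} {t : ℝ} (ht : t ∈ Set.Icc a b) :
    Continuous fun γ : CPath a b n => pev γ t := by
  simp only [pev_of_mem _ ht]
  exact continuous_eval_const _

theorem isClosed_holderHalfSet {a b : ℝ} (hab : a ≤ b) {n : ℕ} {K : Set (Eu n)}
    (hK : IsClosed K) (D : ℝ) : IsClosed (holderHalfSet K D : Set (CPath a b n)) := by
  have hinc : IsClosed {γ : CPath a b n |
      ∀ s t : Set.Icc a b, ‖γ t - γ s‖ ^ 2 ≤ dist s t * D} := by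
    simp only [Set.ofPred_forall]
    exact isClosed_iInter fun s => isClosed_iInter fun t =>
      isClosed_le (by fun_prop) continuous_const
  exact (hK.preimage (continuous_pev (Set.left_mem_Icc.2 hab))).inter hinc

theorem isCompact_holderHalfSet {a b : ℝ} (hab : a ≤ b) {n : ℕ} {K : Set (Eu n)}
    (hK : IsCompact K) (D : ℝ) : IsCompact (holderHalfSet K D : Set (CPath a b n)) := by
  let e := ContinuousMap.isometryEquivBoundedOfCompact (Set.Icc a b) (Eu n)
  obtain ⟨R, hR⟩ := hK.isBounded.exists_norm_le
  rw [← e.toHomeomorph.isCompact_image]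
  refine BoundedContinuousFunction.arzela_ascoli₂
    (Metric.closedBall 0 (R + (1 + (b - a) * |D|))) (isCompact_closedBall _ _) _
    (e.toHomeomorph.isClosed_image.2 (isClosed_holderHalfSet hab hK.isClosed D)) ?_ ?_
  · rintro _ t ⟨γ, ⟨ha, hγ⟩, rfl⟩
    change γ t ∈ _
    rw [mem_closedBall_zero_iff]
    rw [pev_of_mem _ (Set.left_mem_Icc.2 hab)] at ha
    have h1 := hR _ ha
    have h2 := hγ ⟨a, Set.left_mem_Icc.2 hab⟩ t
    have h3 : dist (⟨a, Set.left_mem_Icc.2 hab⟩ : Set.Icc a b) t ≤ b - a :=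
      Real.dist_le_of_mem_Icc (Set.left_mem_Icc.2 hab) t.2
    have h4 : ‖γ t - γ ⟨a, Set.left_mem_Icc.2 hab⟩‖ ^ 2 ≤ (b - a) * |D| :=
      h2.trans ((mul_le_mul_of_nonneg_left (le_abs_self D) dist_nonneg).trans
        (mul_le_mul_of_nonneg_right h3 (abs_nonneg D)))
    have h5 := norm_le_norm_add_norm_sub' (γ t) (γ ⟨a, Set.left_mem_Icc.2 hab⟩)
    nlinarith [sq_nonneg (‖γ t - γ ⟨a, Set.left_mem_Icc.2 hab⟩‖ - 1)]
  · refine Metric.equicontinuous_of_continuity_modulus (fun x => Real.sqrt (x * D)) ?_ _ ?_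
    · have : Continuous fun x : ℝ => Real.sqrt (x * D) := by fun_prop
      simpa using this.tendsto 0
    · rintro s t ⟨_, γ, ⟨-, hγ⟩, rfl⟩
      change dist (γ s) (γ t) ≤ _
      rw [dist_comm, dist_eq_norm]
      exact Real.le_sqrt_of_sq_le (hγ s t)

/-- The quadratic upper bound on `V`, integrated over time, costs at most a quarter of `m E`. -/
theorem exists_potential_mul_le {E : Type*} [NormedAddCommGroup E] {a b : ℝ} (hab : a < b)
    {m : ℝ} (hm : 0 < m) {V : E → ℝ} {c₂ : ℝ} (hc₂ : 0 < c₂)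
    (hV2 : ∀ x, |V x| ≤ c₂ * (1 + ‖x‖ ^ 2))
    (hVt : (∃ CV : ℝ, ∀ x, |V x| ≤ CV) ∨ b - a ≤ Real.sqrt (m / (32 * c₂))) (R : ℝ) :
    ∃ C₀ : ℝ, 0 ≤ C₀ ∧ ∀ x : E, ∀ e : ℝ, 0 ≤ e →
      ‖x‖ ^ 2 ≤ 2 * R ^ 2 + 2 * ((b - a) * e) → V x * (b - a) ≤ C₀ + m / 4 * e := by
  have hba : 0 < b - a := sub_pos.2 hab
  rcases hVt with ⟨CV, hCV⟩ | hT
  · refine ⟨|CV| * (b - a), by positivity, fun x e he _ => ?_⟩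
    have h1 : V x ≤ |CV| := (le_abs_self _).trans ((hCV x).trans (le_abs_self _))
    have h2 := mul_le_mul_of_nonneg_right h1 hba.le
    have h3 : 0 ≤ m / 4 * e := by positivity
    linarith
  · refine ⟨c₂ * (1 + 2 * R ^ 2) * (b - a), by positivity, fun x e he hx => ?_⟩
    have h1 : (b - a) ^ 2 * (32 * c₂) ≤ m :=
      (le_div_iff₀ (by positivity)).1 ((Real.le_sqrt hba.le (by positivity)).1 hT)
    have h2 : V x ≤ c₂ * (1 + (2 * R ^ 2 + 2 * ((b - a) * e))) :=
      (le_abs_self _).trans ((hV2 x).trans (by gcongr))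
    have h3 := mul_le_mul_of_nonneg_right h2 hba.le
    have h4 := mul_le_mul_of_nonneg_right h1 he
    nlinarith [mul_nonneg hm.le he]

theorem IsPartition.mem_Icc {a b : ℝ} {τ : ℕ → ℝ} {l : ℕ} {h : ℝ} (hp : IsPartition a b τ l h)
    {j : ℕ} (hj : j ≤ l) : τ j ∈ Set.Icc a b := by
  obtain ⟨-, h0, hl, hlt, -⟩ := hp
  have hmono : MonotoneOn τ (Set.Icc 0 l) :=
    monotoneOn_of_le_succ Set.ordConnected_Icc fun i _ _ hi => (hlt i (Nat.lt_of_succ_le hi.2)).le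
  rw [← h0, ← hl]
  exact ⟨hmono ⟨le_rfl, Nat.zero_le _⟩ ⟨Nat.zero_le _, hj⟩ (Nat.zero_le _),
    hmono ⟨Nat.zero_le _, hj⟩ ⟨Nat.zero_le _, le_rfl⟩ hj⟩

/-- The kinetic energy (up to the factor `m / 2`) of a curve sampled along a partition. -/
noncomputable def kineticSum {a b : ℝ} {n : ℕ} (τ : ℕ → ℝ) (l : ℕ) (γ : CPath a b n) : ℝ :=
  ∑ j ∈ Finset.range l, ‖pev γ (τ (j + 1)) - pev γ (τ j)‖ ^ 2 / (τ (j + 1) - τ j)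

theorem IsPartition.kineticSum_nonneg {a b : ℝ} {n : ℕ} {τ : ℕ → ℝ} {l : ℕ} {h : ℝ}
    (hp : IsPartition a b τ l h) (γ : CPath a b n) : 0 ≤ kineticSum τ l γ :=
  Finset.sum_nonneg fun j hj => div_nonneg (sq_nonneg _)
    (sub_pos.2 (hp.2.2.2.1 j (Finset.mem_range.1 hj))).le

theorem PiecewiseAffine.sq_norm_sub_le {a b : ℝ} {n : ℕ} {τ : ℕ → ℝ} {l : ℕ} {h : ℝ}
    {γ : CPath a b n} (hγ : PiecewiseAffine a b τ l γ) (hp : IsPartition a b τ l h)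
    {s t : ℝ} (hs : a ≤ s) (hst : s ≤ t) (ht : t ≤ b) :
    ‖pev γ t - pev γ s‖ ^ 2 ≤ (t - s) * kineticSum τ l γ := by
  refine sq_norm_sub_le_of_piecewise_affine hp.2.2.2.1 (fun j hj t ht => ?_) l le_rfl s t
    (hp.2.1.trans_le hs) hst (ht.trans_eq hp.2.2.1.symm)
  have htI : t ∈ Set.Icc a b :=
    ⟨(hp.mem_Icc hj.le).1.trans ht.1, ht.2.trans (hp.mem_Icc hj).2⟩
  rw [pev_of_mem γ htI]
  exact hγ j hj ⟨t, htI⟩ ht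

theorem PiecewiseAffine.mem_holderHalfSet {a b : ℝ} {n : ℕ} {τ : ℕ → ℝ} {l : ℕ} {h : ℝ}
    {γ : CPath a b n} (hγ : PiecewiseAffine a b τ l γ) (hp : IsPartition a b τ l h)
    {K : Set (Eu n)} (hK : pev γ a ∈ K) {D : ℝ} (hD : kineticSum τ l γ ≤ D) :
    γ ∈ holderHalfSet K D := by
  have key : ∀ s t : Set.Icc a b, s ≤ t → ‖γ t - γ s‖ ^ 2 ≤ dist s t * D := fun s t hst => by
    have h1 := hγ.sq_norm_sub_le hp s.2.1 hst t.2.2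
    rw [pev_of_mem γ s.2, pev_of_mem γ t.2] at h1
    have h2 : dist s t = (t : ℝ) - s := by
      rw [dist_comm, Subtype.dist_eq, Real.dist_eq,
        abs_of_nonneg (sub_nonneg.2 (Subtype.coe_le_coe.2 hst))]
    rw [h2]
    exact h1.trans (mul_le_mul_of_nonneg_left hD (sub_nonneg.2 (Subtype.coe_le_coe.2 hst)))
  refine ⟨hK, fun s t => ?_⟩
  rcases le_total s t with hst | hst
  · exact key s t hst
  · rw [norm_sub_rev, dist_comm]
    exact key t s hst

/-- Coercivity of the discrete action, uniformly in the partition. -/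
theorem exists_kineticSum_sub_le_dActionSum {n : ℕ} {a b : ℝ} (hab : a < b)
    {m : ℝ} (hm : 0 < m) {V : Eu n → ℝ} {c₂ : ℝ} (hc₂ : 0 < c₂)
    (hV2 : ∀ x : Eu n, |V x| ≤ c₂ * (1 + ‖x‖ ^ 2))
    (hVt : (∃ CV : ℝ, ∀ x, |V x| ≤ CV) ∨ b - a ≤ Real.sqrt (m / (32 * c₂))) (R : ℝ) :
    ∃ C₀ : ℝ, 0 ≤ C₀ ∧ ∀ (τ : ℕ → ℝ) (l : ℕ) (h : ℝ), IsPartition a b τ l h →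
      ∀ γ : CPath a b n, PiecewiseAffine a b τ l γ → ‖pev γ a‖ ≤ R →
        m / 4 * kineticSum τ l γ - C₀ ≤ dActionSum m V τ l γ := by
  obtain ⟨C₀, hC₀, H⟩ := exists_potential_mul_le hab hm hc₂ hV2 hVt R
  refine ⟨C₀, hC₀, fun τ l h hp γ hγ hR => ?_⟩
  have hba : 0 < b - a := sub_pos.2 hab
  have hE := hp.kineticSum_nonneg γ
  have hnode : ∀ j ≤ l, ‖pev γ (τ j) - pev γ a‖ ^ 2 ≤ (b - a) * kineticSum τ l γ := fun j hj =>
    (hγ.sq_norm_sub_le hp le_rfl (hp.mem_Icc hj).1 (hp.mem_Icc hj).2).trans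
      (mul_le_mul_of_nonneg_right (by linarith [(hp.mem_Icc hj).2]) hE)
  have hmid : ∀ j ∈ Finset.range l,
      V ((2 : ℝ)⁻¹ • (pev γ (τ (j + 1)) + pev γ (τ j))) * (τ (j + 1) - τ j) ≤
        (C₀ + m / 4 * kineticSum τ l γ) / (b - a) * (τ (j + 1) - τ j) := fun j hj => by
    have hj' := Finset.mem_range.1 hj
    refine mul_le_mul_of_nonneg_right ?_ (sub_pos.2 (hp.2.2.2.1 j hj')).le
    rw [le_div_iff₀ hba]
    refine H _ _ hE ?_
    have h1 := hnode j hj'.le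
    have h2 := hnode (j + 1) hj'
    set x := pev γ (τ (j + 1))
    set y := pev γ (τ j)
    set p := pev γ a
    have h3 : ‖(2 : ℝ)⁻¹ • (x + y)‖ ≤ ‖p‖ + 2⁻¹ * (‖x - p‖ + ‖y - p‖) := by
      have hsplit : (2 : ℝ)⁻¹ • (x + y) = p + (2 : ℝ)⁻¹ • ((x - p) + (y - p)) := by module
      rw [hsplit]
      refine (norm_add_le _ _).trans (add_le_add_right ?_ _)
      rw [norm_smul, Real.norm_of_nonneg (by norm_num)]
      exact mul_le_mul_of_nonneg_left (norm_add_le _ _) (by norm_num)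
    have h4 := pow_le_pow_left₀ (norm_nonneg _) h3 2
    have h5 := pow_le_pow_left₀ (norm_nonneg _) hR 2
    nlinarith [sq_nonneg (‖p‖ - 2⁻¹ * (‖x - p‖ + ‖y - p‖)), sq_nonneg (‖x - p‖ - ‖y - p‖)]
  have hsum := Finset.sum_le_sum hmid
  rw [← Finset.mul_sum, Finset.sum_range_sub, hp.2.1, hp.2.2.1, div_mul_cancel₀ _ hba.ne'] at hsum
  have hsplit : dActionSum m V τ l γ = m / 2 * kineticSum τ l γ -
      ∑ j ∈ Finset.range l,
        V ((2 : ℝ)⁻¹ • (pev γ (τ (j + 1)) + pev γ (τ j))) * (τ (j + 1) - τ j) := by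
    rw [dActionSum, kineticSum, Finset.sum_sub_distrib, Finset.mul_sum]
    simp only [mul_div_assoc]
  linarith

theorem epos_coe (x : ℝ) : epos (x : EReal) = ENNReal.ofReal x := by
  simp [epos]

theorem epos_mono {x y : EReal} (hxy : x ≤ y) : epos x ≤ epos y := by
  induction y with
  | top => simp [epos]
  | bot => simp [le_bot_iff.1 hxy]
  | coe y =>
    induction x with
    | top => simp at hxy
    | bot => simp [epos]
    | coe x =>
      rw [epos_coe, epos_coe]
      exact ENNReal.ofReal_le_ofReal (EReal.coe_le_coe_iff.1 hxy)

/-- Markov's inequality for the extended integral of a function that is bounded below; no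
measurability of the function is needed. -/
theorem mul_measure_compl_le_of_mint_le {X : Type*} [MeasurableSpace X] {π : Measure X}
    [IsProbabilityMeasure π] {F : X → EReal} {C C₀ M : ℝ} {S : Set X} (hS : MeasurableSet S)
    (hC₀ : 0 ≤ C₀) (hlow : ∀ᵐ x ∂π, ((-C₀ : ℝ) : EReal) ≤ F x)
    (hM : ∀ᵐ x ∂π, x ∉ S → (M : EReal) ≤ F x) (hF : mint F π ≤ (C : EReal)) :
    ENNReal.ofReal M * π Sᶜ ≤ ENNReal.ofReal (C + C₀) := by
  have hneg : ∫⁻ x, epos (-(F x)) ∂π ≤ ENNReal.ofReal C₀ := by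
    calc ∫⁻ x, epos (-(F x)) ∂π ≤ ∫⁻ _, ENNReal.ofReal C₀ ∂π := by
          refine lintegral_mono_ae (hlow.mono fun x hx => ?_)
          rw [← epos_coe]
          refine epos_mono (EReal.neg_le.1 ?_)
          simpa using hx
      _ = ENNReal.ofReal C₀ := by simp
  have hpos : ∫⁻ x, epos (F x) ∂π ≤ ENNReal.ofReal (C + C₀) := by
    unfold mint at hF
    generalize ∫⁻ x, epos (F x) ∂π = P at hF ⊢
    generalize ∫⁻ x, epos (-(F x)) ∂π = Q at hF hneg
    lift Q to ℝ≥0 using ne_top_of_le_ne_top ENNReal.ofReal_ne_top hneg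
    have hQ : (Q : ℝ) ≤ C₀ := by
      simpa using ENNReal.toReal_mono ENNReal.ofReal_ne_top hneg |>.trans_eq
        (ENNReal.toReal_ofReal hC₀)
    rcases eq_or_ne P ⊤ with rfl | hP
    · exfalso
      have : (⊤ : EReal) - ((Q : ℝ) : EReal) ≤ (C : EReal) := hF
      simp at this
    · lift P to ℝ≥0 using hP
      have h1 : (((P : ℝ) : EReal) - ((Q : ℝ) : EReal)) ≤ (C : EReal) := hF
      rw [← EReal.coe_sub, EReal.coe_le_coe_iff] at h1
      rw [← ENNReal.ofReal_coe_nnreal]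
      exact ENNReal.ofReal_le_ofReal (by linarith)
  refine le_trans ?_ hpos
  rw [← lintegral_indicator_const hS.compl]
  refine lintegral_mono_ae (hM.mono fun x hx => ?_)
  by_cases hxS : x ∈ S
  · simp [hxS]
  · simpa [hxS, ← epos_coe] using epos_mono (hx hxS)

/-- Sequential form of Prokhorov's theorem. -/
theorem exists_subseq_weakLim_of_tight {X : Type*} [MetricSpace X]
    [TopologicalSpace.SeparableSpace X] [MeasurableSpace X] [BorelSpace X] {μ : ℕ → Measure X}
    (hμ : ∀ k, IsProbabilityMeasure (μ k))
    (ht : ∀ ε : ℝ≥0∞, 0 < ε → ∃ S : Set X, IsCompact S ∧ ∀ k, μ k Sᶜ ≤ ε) :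
    ∃ ψ : ℕ → ℕ, StrictMono ψ ∧ ∃ π : Measure X,
      IsProbabilityMeasure π ∧ WeakLim (fun k => μ (ψ k)) π := by
  let ν : ℕ → ProbabilityMeasure X := fun k => ⟨μ k, hμ k⟩
  have hc : IsCompact (closure (Set.range ν)) := by
    refine isCompact_closure_of_isTightMeasureSet
      (isTightMeasureSet_iff_exists_isCompact_measure_compl_le.2 fun ε hε => ?_)
    obtain ⟨S, hS, hle⟩ := ht ε hε
    refine ⟨S, hS, ?_⟩
    rintro _ ⟨_, ⟨k, rfl⟩, rfl⟩
    exact hle k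
  obtain ⟨π, -, ψ, hψ, hlim⟩ := hc.tendsto_subseq fun k => subset_closure (Set.mem_range_self k)
  exact ⟨ψ, hψ, π, π.2, ProbabilityMeasure.tendsto_iff_forall_integral_tendsto.1 hlim⟩

/-- **Compactness for the time-discretized scheme (Theorem 5.2).**
For `L(x,v) = (m/2)|v|² − V(x)` with `|V(x)| ≤ c₂(1+|x|²)`, if `V` is bounded or
`b − a ≤ √(m/(32c₂))` and the mesh sizes `h_N → 0`, then every sequence of probability
measures on `C([a,b];ℝⁿ)` with initial marginals supported in one compact set and
uniformly bounded discrete actions is relatively compact for weak convergence. -/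
theorem compactness_time_discretized
    {n : ℕ} (hn : 1 ≤ n) {a b : ℝ} (hab : a < b)
    (m : ℝ) (hm : 0 < m) (V : Eu n → ℝ) (hV1 : ContDiff ℝ (⊤ : ℕ∞) V)
    (c₂ : ℝ) (hc₂ : 0 < c₂) (hV2 : ∀ x : Eu n, |V x| ≤ c₂ * (1 + ‖x‖ ^ 2))
    (hVt : (∃ CV : ℝ, ∀ x, |V x| ≤ CV) ∨ b - a ≤ Real.sqrt (m / (32 * c₂)))
    (h : ℕ → ℝ) (hpos : ∀ N, 0 < h N) (hto0 : Tendsto h atTop (𝓝 0))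
    (l : ℕ → ℕ) (τ : ℕ → ℕ → ℝ) (hpart : ∀ N, IsPartition a b (τ N) (l N) (h N))
    (πs : ℕ → Measure (CPath a b n)) (hprob : ∀ N, IsProbabilityMeasure (πs N))
    (K : Set (Eu n)) (hK : IsCompact K)
    (hKsupp : ∀ N, Measure.map (fun γ => pev γ a) (πs N) K = 1)
    (C : ℝ) (hC : ∀ N, mint (dAction m V a b (τ N) (l N)) (πs N) ≤ (C : EReal)) :
    ∀ φ : ℕ → ℕ, StrictMono φ →
      ∃ ψ : ℕ → ℕ, StrictMono ψ ∧ ∃ π : Measure (CPath a b n),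
        IsProbabilityMeasure π ∧ WeakLim (fun k => πs (φ (ψ k))) π := by
  intro φ _
  obtain ⟨R, hR⟩ := hK.isBounded.exists_norm_le
  obtain ⟨C₀, hC₀, hcoer⟩ := exists_kineticSum_sub_le_dActionSum hab hm hc₂ hV2 hVt R
  refine exists_subseq_weakLim_of_tight (fun k => hprob (φ k)) fun ε hε => ?_
  rcases eq_or_ne ε ⊤ with rfl | hεt
  · exact ⟨∅, isCompact_empty, fun _ => le_top⟩
  have hε' : 0 < ε.toReal := ENNReal.toReal_pos hε.ne' hεt
  set M : ℝ := (|C + C₀| + 1) / ε.toReal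
  have hMpos : 0 < M := by positivity
  have hS := isCompact_holderHalfSet hab.le hK (4 * (M + C₀) / m)
  refine ⟨_, hS, fun k => ?_⟩
  have := hprob (φ k)
  have hstart : ∀ᵐ γ ∂(πs (φ k)), pev γ a ∈ K := by
    have hmeas := (continuous_pev (n := n) (Set.left_mem_Icc.2 hab.le)).measurable
    have hK1 := hKsupp (φ k)
    rw [Measure.map_apply hmeas hK.measurableSet] at hK1
    exact (prob_compl_eq_zero_iff (hmeas hK.measurableSet)).2 hK1
  have hmarkov := mul_measure_compl_le_of_mint_le (M := M) hS.isClosed.measurableSet hC₀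
    (hstart.mono fun γ hγ => ?_) (hstart.mono fun γ hγ hγS => ?_) (hC (φ k))
  · have hM0 : ENNReal.ofReal M ≠ 0 := (ENNReal.ofReal_pos.2 hMpos).ne'
    calc πs (φ k) (holderHalfSet K (4 * (M + C₀) / m))ᶜ
        ≤ ENNReal.ofReal (C + C₀) / ENNReal.ofReal M := by
          rw [ENNReal.le_div_iff_mul_le (.inl hM0) (.inl ENNReal.ofReal_ne_top), mul_comm]
          exact hmarkov
      _ = ENNReal.ofReal ((C + C₀) / M) := (ENNReal.ofReal_div_of_pos hMpos).symm
      _ ≤ ENNReal.ofReal ε.toReal := by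
          refine ENNReal.ofReal_le_ofReal ((div_le_iff₀ hMpos).2 ?_)
          rw [mul_div_cancel₀ _ hε'.ne']
          linarith [le_abs_self (C + C₀)]
      _ = ε := ENNReal.ofReal_toReal hεt
  · by_cases hPA : PiecewiseAffine a b (τ (φ k)) (l (φ k)) γ
    · rw [dAction, if_pos hPA, EReal.coe_le_coe_iff]
      have h1 := hcoer _ _ _ (hpart (φ k)) γ hPA (hR _ hγ)
      have h2 := (hpart (φ k)).kineticSum_nonneg γ
      have h3 : 0 ≤ m / 4 * kineticSum (τ (φ k)) (l (φ k)) γ := by positivity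
      linarith
    · rw [dAction, if_neg hPA]
      exact le_top
  · by_cases hPA : PiecewiseAffine a b (τ (φ k)) (l (φ k)) γ
    · rw [dAction, if_pos hPA, EReal.coe_le_coe_iff]
      have h1 := hcoer _ _ _ (hpart (φ k)) γ hPA (hR _ hγ)
      by_contra! hlt
      refine hγS (hPA.mem_holderHalfSet (hpart (φ k)) hγ ?_)
      rw [le_div_iff₀ hm]
      linarith
    · rw [dAction, if_neg hPA]
      exact le_top
end

section
/- (Coercivity of the action, Lemma 3.4.) For every compact set K ⊆ ℝⁿ and every constant C > 0, the set { γ ∈ C([a,b];ℝⁿ) : γ(a) ∈ K and 𝒜(γ) ≤ C } is relatively compact in (C([a,b];ℝⁿ), d_Γ), i.e. its closure is compact. -/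
open MeasureTheory Filter Topology
open scoped ENNReal NNReal

/-- Quadratic lower bound for a `C²` function whose second derivative is bounded below. -/
theorem quadratic_lower_bound {E : Type*} [NormedAddCommGroup E] [NormedSpace ℝ E]
    {f : E → ℝ} (hf : ContDiff ℝ 2 f) {c : ℝ} {v : E}
    (h : ∀ x : E, c * ‖v‖ ^ 2 ≤ fderiv ℝ (fderiv ℝ f) x v v) :
    f 0 + fderiv ℝ f 0 v + c / 2 * ‖v‖ ^ 2 ≤ f v := by
  have hline : ∀ t : ℝ, HasDerivAt (fun s : ℝ => s • v) v t := fun t => by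
    simpa using (hasDerivAt_id t).smul_const v
  have hf1 : Differentiable ℝ f := hf.differentiable (by norm_num)
  have hf2 : Differentiable ℝ (fderiv ℝ f) :=
    (hf.fderiv_right (m := 1) (by norm_num)).differentiable (by norm_num)
  have hφ : ∀ t : ℝ, HasDerivAt (fun s : ℝ => f (s • v)) (fderiv ℝ f (t • v) v) t := fun t =>
    HasFDerivAt.comp_hasDerivAt (l := f) t (hf1 (t • v)).hasFDerivAt (hline t)
  have hφ' : ∀ t : ℝ, HasDerivAt (fun s : ℝ => fderiv ℝ f (s • v) v)
      (fderiv ℝ (fderiv ℝ f) (t • v) v v) t := fun t => by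
    simpa using (HasFDerivAt.comp_hasDerivAt (l := fderiv ℝ f) t (hf2 (t • v)).hasFDerivAt
      (hline t)).clm_apply
      (hasDerivAt_const t v)
  have hG : ∀ t : ℝ, HasDerivAt (fun s : ℝ => fderiv ℝ f (s • v) v - c * ‖v‖ ^ 2 * s)
      (fderiv ℝ (fderiv ℝ f) (t • v) v v - c * ‖v‖ ^ 2) t := fun t => by
    exact ((hφ' t).sub ((hasDerivAt_id t).const_mul (c * ‖v‖ ^ 2))).congr_deriv (by simp)
  have hGmono : Monotone (fun s : ℝ => fderiv ℝ f (s • v) v - c * ‖v‖ ^ 2 * s) := by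
    refine monotone_of_deriv_nonneg (fun t => (hG t).differentiableAt) fun t => ?_
    rw [(hG t).deriv]
    exact sub_nonneg.2 (h _)
  have hH : ∀ t : ℝ, HasDerivAt
      (fun s : ℝ => f (s • v) - fderiv ℝ f 0 v * s - c * ‖v‖ ^ 2 / 2 * s ^ 2)
      (fderiv ℝ f (t • v) v - fderiv ℝ f 0 v - c * ‖v‖ ^ 2 * t) t := fun t => by
    refine (((hφ t).sub ((hasDerivAt_id t).const_mul (fderiv ℝ f 0 v))).sub
      ((hasDerivAt_pow 2 t).const_mul (c * ‖v‖ ^ 2 / 2))).congr_deriv ?_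
    norm_num
    ring
  have hHmono : MonotoneOn
      (fun s : ℝ => f (s • v) - fderiv ℝ f 0 v * s - c * ‖v‖ ^ 2 / 2 * s ^ 2)
      (Set.Icc 0 1) := by
    refine monotoneOn_of_deriv_nonneg (convex_Icc 0 1)
      (fun t _ => (hH t).continuousAt.continuousWithinAt)
      (fun t _ => (hH t).differentiableAt.differentiableWithinAt) fun t ht => ?_
    rw [interior_Icc] at ht
    rw [(hH t).deriv]
    have := hGmono ht.1.le
    simp only [zero_smul, mul_zero, sub_zero] at this
    linarith
  have := hHmono (Set.left_mem_Icc.2 zero_le_one) (Set.right_mem_Icc.2 zero_le_one) zero_le_one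
  simp only [zero_smul, one_smul] at this
  linarith

/-- A Lagrangian that is uniformly convex in the velocity over a compact set of positions grows
superlinearly in the velocity, uniformly over that set. -/
theorem superlinear_of_uniformly_convex {E F : Type*} [NormedAddCommGroup E] [NormedSpace ℝ E]
    [NormedAddCommGroup F] [NormedSpace ℝ F]
    {L : E → F → ℝ} (hL : ContDiff ℝ 2 (Function.uncurry L)) {K : Set E} (hK : IsCompact K)
    {c : ℝ} (hc : 0 < c)
    (h : ∀ x ∈ K, ∀ v w : F, c * ‖w‖ ^ 2 ≤ fderiv ℝ (fderiv ℝ (L x)) v w w) (l : ℝ) :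
    ∃ B : ℝ, ∀ x ∈ K, ∀ v : F, l * ‖v‖ ≤ L x v + B := by
  have hcont0 : Continuous fun x => L x 0 :=
    hL.continuous.comp (continuous_id.prodMk continuous_const)
  have hcont1 : Continuous fun x => fderiv ℝ (L x) 0 :=
    (ContDiff.fderiv (n := 1) (g := fun _ : E => (0 : F)) hL contDiff_const
      (by norm_num)).continuous
  obtain ⟨M₀, hM₀⟩ := hK.exists_bound_of_continuousOn hcont0.continuousOn
  obtain ⟨M₁, hM₁⟩ := hK.exists_bound_of_continuousOn hcont1.continuousOn
  refine ⟨M₀ + (M₁ + l) ^ 2 / (2 * c), fun x hx v => ?_⟩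
  have hLx : ContDiff ℝ 2 (L x) := hL.comp (contDiff_const.prodMk contDiff_id)
  have hquad := quadratic_lower_bound hLx (v := v) fun y => h x hx y v
  have h0 := neg_le_of_abs_le (hM₀ x hx)
  have h1 : -(M₁ * ‖v‖) ≤ fderiv ℝ (L x) 0 v :=
    neg_le_of_abs_le ((fderiv ℝ (L x) 0).le_of_opNorm_le (hM₁ x hx) v)
  have hsq : (M₁ + l) * ‖v‖ ≤ c / 2 * ‖v‖ ^ 2 + (M₁ + l) ^ 2 / (2 * c) := by
    have : c / 2 * ‖v‖ ^ 2 + (M₁ + l) ^ 2 / (2 * c) - (M₁ + l) * ‖v‖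
        = (c * ‖v‖ - (M₁ + l)) ^ 2 / (2 * c) := by
      field_simp
      ring
    have : 0 ≤ (c * ‖v‖ - (M₁ + l)) ^ 2 / (2 * c) := by positivity
    linarith
  linarith

/-- A curve of finite action has a derivative along which the Lagrangian is integrable. -/
theorem exists_deriv_of_action_le {n : ℕ} {L : Eu n → Eu n → ℝ} {a b : ℝ} {γ : CPath a b n}
    {C : ℝ} (h : action L a b γ ≤ (C : EReal)) :
    ∃ g : ℝ → Eu n, IntegrableOn g (Set.Icc a b) ∧
      (∀ s t : Set.Icc a b, γ t = γ s + ∫ u in (s : ℝ)..(t : ℝ), g u) ∧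
      IntegrableOn (fun t => L (pev γ t) (g t)) (Set.Icc a b) ∧
      ∫ t in Set.Icc a b, L (pev γ t) (g t) ≤ C := by
  unfold action at h
  split_ifs at h with h₁ h₂
  · exact ⟨h₁.choose, h₁.choose_spec.1, h₁.choose_spec.2, h₂, EReal.coe_le_coe_iff.1 h⟩
  · exact absurd h (by simp)
  · exact absurd h (by simp)

/-- Increments of a primitive are controlled by a function dominating the norm of the
derivative. -/
theorem mul_norm_integral_le {E : Type*} [NormedAddCommGroup E] [NormedSpace ℝ E]
    {a b : ℝ} {g : ℝ → E} {F : ℝ → ℝ} (hg : IntegrableOn g (Set.Icc a b))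
    (hF : IntegrableOn F (Set.Icc a b)) {l B c C : ℝ} (hl : 0 ≤ l)
    (hB : ∀ u ∈ Set.Icc a b, l * ‖g u‖ ≤ F u + B) (hc : ∀ u ∈ Set.Icc a b, 0 ≤ F u + c)
    (hC : ∫ u in Set.Icc a b, F u ≤ C) {s t : ℝ} (hs : s ∈ Set.Icc a b) (ht : t ∈ Set.Icc a b)
    (hst : s ≤ t) :
    l * ‖∫ u in s..t, g u‖ ≤ C + c * (b - a) + (B - c) * (t - s) := by
  have hsub : Set.Ioc s t ⊆ Set.Icc a b := fun u hu => ⟨hs.1.trans hu.1.le, hu.2.trans ht.2⟩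
  have hab : a ≤ b := hs.1.trans hs.2
  have hFc : IntegrableOn (fun u => F u + c) (Set.Icc a b) :=
    hF.add (integrableOn_const (by simp))
  have hconst : IntegrableOn (fun _ : ℝ => B - c) (Set.Ioc s t) := integrableOn_const (by simp)
  calc l * ‖∫ u in s..t, g u‖ ≤ l * ∫ u in Set.Ioc s t, ‖g u‖ := by
        rw [intervalIntegral.integral_of_le hst]
        exact mul_le_mul_of_nonneg_left (norm_integral_le_integral_norm _) hl
    _ = ∫ u in Set.Ioc s t, l * ‖g u‖ := (integral_const_mul _ _).symm
    _ ≤ ∫ u in Set.Ioc s t, ((F u + c) + (B - c)) := by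
        refine setIntegral_mono_on ((hg.mono_set hsub).norm.const_mul l)
          ((hFc.mono_set hsub).add hconst) measurableSet_Ioc fun u hu => ?_
        linarith [hB u (hsub hu)]
    _ = (∫ u in Set.Ioc s t, (F u + c)) + (B - c) * (t - s) := by
        rw [integral_add (hFc.mono_set hsub) hconst, setIntegral_const]
        simp [Measure.real, hst, mul_comm]
    _ ≤ (∫ u in Set.Icc a b, (F u + c)) + (B - c) * (t - s) := by
        refine add_le_add ?_ le_rfl
        refine setIntegral_mono_set hFc ?_ hsub.eventuallyLE
        exact (ae_restrict_iff' measurableSet_Icc).2 (Eventually.of_forall hc)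
    _ = (∫ u in Set.Icc a b, F u) + c * (b - a) + (B - c) * (t - s) := by
        rw [integral_add hF (integrableOn_const (by simp)), setIntegral_const]
        simp [Measure.real, hab, mul_comm]
    _ ≤ C + c * (b - a) + (B - c) * (t - s) := by gcongr

/-- **Arzelà–Ascoli** for continuous maps on a compact space. -/
theorem isCompact_closure_of_equicontinuous {X Y : Type*} [TopologicalSpace X] [CompactSpace X]
    [MetricSpace Y] {A : Set C(X, Y)} {Q : Set Y} (hQ : IsCompact Q)
    (hAQ : ∀ f ∈ A, ∀ x, f x ∈ Q) (hA : Equicontinuous fun (f : A) (x : X) => (f : C(X, Y)) x) :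
    IsCompact (closure A) := by
  let e := ContinuousMap.isometryEquivBoundedOfCompact X Y
  have key : IsCompact (closure (e '' A)) := by
    refine BoundedContinuousFunction.arzela_ascoli Q hQ _ ?_ ?_
    · rintro _ x ⟨f, hf, rfl⟩
      exact hAQ f hf x
    · intro x U hU
      filter_upwards [hA x U hU] with y hy
      rintro ⟨_, f, hf, rfl⟩
      exact hy ⟨f, hf⟩
  exact e.toHomeomorph.isCompact_image.1 ((e.toHomeomorph.image_closure A).symm ▸ key)

/-- **Coercivity of the action (Lemma 3.4).**
For every compact `K ⊆ ℝⁿ` and every `C > 0`, the set of curves starting in `K` with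
action at most `C` is relatively compact in `(C([a,b];ℝⁿ), d_Γ)`. -/
theorem action_sublevels_relatively_compact
    {n : ℕ} (hn : 1 ≤ n) {a b : ℝ} (hab : a < b)
    (L : Eu n → Eu n → ℝ)
    (hL1 : ContDiff ℝ (⊤ : ℕ∞) (Function.uncurry L))
    (hL2 : ∀ K : Set (Eu n), IsCompact K → ∃ c₀ : ℝ, 0 < c₀ ∧
      ∀ x ∈ K, ∀ v w : Eu n, c₀ * ‖w‖ ^ 2 ≤ fderiv ℝ (fderiv ℝ (L x)) v w w)
    (c₁ c₂ : ℝ) (hc₁ : 0 < c₁) (hc₂ : 0 < c₂)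
    (hL3 : ∀ x v : Eu n, c₁ * ‖v‖ - c₂ ≤ L x v)
    (K : Set (Eu n)) (hK : IsCompact K) (C : ℝ) (hC : 0 < C) :
    IsCompact (closure {γ : CPath a b n | pev γ a ∈ K ∧ action L a b γ ≤ (C : EReal)}) := by
  have hpev : ∀ (γ : CPath a b n) (t : Set.Icc a b), pev γ t = γ t := fun γ t => by
    simp [pev, t.2]
  set D := C + c₂ * (b - a) with hD
  have hDpos : 0 < D := by
    have := mul_pos hc₂ (sub_pos.2 hab)
    positivity
  obtain ⟨R, hR⟩ := hK.isBounded.exists_norm_le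
  let t₀ : Set.Icc a b := ⟨a, Set.left_mem_Icc.2 hab.le⟩
  have hball : ∀ γ ∈ {γ : CPath a b n | pev γ a ∈ K ∧ action L a b γ ≤ (C : EReal)},
      ∀ t, γ t ∈ Metric.closedBall (0 : Eu n) (R + D / c₁) := by
    rintro γ ⟨hγK, hγ⟩ t
    obtain ⟨g, hg, hγg, hF, hFC⟩ := exists_deriv_of_action_le hγ
    have hest := mul_norm_integral_le (B := c₂) (c := c₂) hg hF hc₁.le
      (fun u _ => by linarith [hL3 (pev γ u) (g u)])
      (fun u _ => by linarith [hL3 (pev γ u) (g u), mul_nonneg hc₁.le (norm_nonneg (g u))])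
      hFC t₀.2 t.2 t.2.1
    have hdisp : ‖∫ u in (t₀ : ℝ)..t, g u‖ ≤ D / c₁ := by
      rw [le_div_iff₀ hc₁]
      linarith
    rw [mem_closedBall_zero_iff, hγg t₀ t]
    refine (norm_add_le _ _).trans (add_le_add ?_ hdisp)
    rw [← hpev]
    exact hR _ hγK
  refine isCompact_closure_of_equicontinuous (isCompact_closedBall _ _) hball ?_
  intro t
  rw [Metric.equicontinuousAt_iff]
  intro ε hε
  have hl : 0 < 2 * D / ε := by positivity
  obtain ⟨c₀, hc₀, hconv⟩ := hL2 _ (isCompact_closedBall (0 : Eu n) (R + D / c₁))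
  obtain ⟨B, hB⟩ := superlinear_of_uniformly_convex (contDiff_infty.1 hL1 2)
    (isCompact_closedBall _ _) hc₀ hconv (2 * D / ε)
  refine ⟨D / (|B - c₂| + 1), by positivity, fun s hst => ?_⟩
  rintro ⟨γ, hγ⟩
  obtain ⟨g, hg, hγg, hF, hFC⟩ := exists_deriv_of_action_le hγ.2
  have hinc : ∀ x y : Set.Icc a b, (x : ℝ) ≤ y → dist x y < D / (|B - c₂| + 1) →
      dist (γ x) (γ y) < ε := by
    intro x y hxy hd
    have hest := mul_norm_integral_le (c := c₂) hg hF hl.le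
      (fun u hu => hB _ (by rw [hpev γ ⟨u, hu⟩]; exact hball γ hγ _) _)
      (fun u _ => by linarith [hL3 (pev γ u) (g u), mul_nonneg hc₁.le (norm_nonneg (g u))])
      hFC x.2 y.2 hxy
    rw [Subtype.dist_eq, Real.dist_eq, abs_sub_comm, abs_of_nonneg (sub_nonneg.2 hxy),
      lt_div_iff₀ (by positivity)] at hd
    have hlt : (B - c₂) * ((y : ℝ) - x) < D := by
      nlinarith [mul_le_mul_of_nonneg_right (le_abs_self (B - c₂)) (sub_nonneg.2 hxy)]
    have hdist : dist (γ x) (γ y) = ‖∫ u in (x : ℝ)..y, g u‖ := by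
      rw [hγg x y, dist_self_add_right]
    have hlt' : 2 * D / ε * dist (γ x) (γ y) < 2 * D / ε * ε := by
      rw [hdist, div_mul_cancel₀ _ hε.ne']
      linarith
    exact lt_of_mul_lt_mul_left hlt' hl.le
  rcases le_total (t : ℝ) s with h | h
  · exact hinc t s h (by rwa [dist_comm])
  · rw [dist_comm]
    exact hinc s t h hst
end
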